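/- There are uncountably many minor-closed classes of countable graphs that have a minor-universal element. That is, there exists an uncountable family of pairwise distinct minor-closed classes of countable graphs, each of which contains a graph U such that every graph in the class is a minor of U. -/

import Mathlib

/-- `H` is a minor of `G`: pairwise disjoint nonempty connected branch sets, one for each
vertex of `H`, with a `G`-edge between the branch sets of any two `H`-adjacent vertices. -/
def IsMinor {V : Type*} {W : Type*} (H : SimpleGraph V) (G : SimpleGraph W) : Prop :=
  ∃ B : V → Set W,
    (∀ v : V, (G.induce (B v)).Connected) ∧
    (∀ u v : V, u ≠ v → Disjoint (B u) (B v)) ∧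
    (∀ u v : V, H.Adj u v → ∃ x ∈ B u, ∃ y ∈ B v, G.Adj x y)

/-- A countable graph: a simple graph together with its (countable) vertex type. -/
structure CGraph where
  V : Type
  countable : Countable V
  graph : SimpleGraph V

/-- A class of countable graphs is minor-closed if it contains every countable graph that
is a minor of one of its members.  (Since isomorphic graphs are minors of one another,
such a class is in particular closed under isomorphism.) -/
def MinorClosed (C : Set CGraph) : Prop :=
  ∀ G ∈ C, ∀ H : CGraph, IsMinor H.graph G.graph → H ∈ C

/-- `C` has a minor-universal element: some `U ∈ C` containing every member of `C`
as a minor. -/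
def HasUniversal (C : Set CGraph) : Prop :=
  ∃ U ∈ C, ∀ G ∈ C, IsMinor G.graph U.graph

namespace SimpleGraph

variable {W X : Type*}

/-- A `G`-connected family of connected sets, consecutive ones being joined by an edge, has a
connected union. -/
lemma connected_induce_biUnion {G : SimpleGraph W} {K : SimpleGraph X} {C : W → Set X}
    (hC : ∀ w, (K.induce (C w)).Connected)
    (hadj : ∀ u v, G.Adj u v → ∃ x ∈ C u, ∃ y ∈ C v, K.Adj x y)
    {S : Set W} (hS : (G.induce S).Connected) :
    (K.induce (⋃ w ∈ S, C w)).Connected := by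
  have hsub : ∀ w ∈ S, C w ⊆ ⋃ w ∈ S, C w := fun w hw => Set.subset_biUnion_of_mem hw
  have same : ∀ (w : S) (a b : X) (ha : a ∈ C w) (hb : b ∈ C w),
      (K.induce (⋃ w ∈ S, C w)).Reachable ⟨a, hsub w w.2 ha⟩ ⟨b, hsub w w.2 hb⟩ :=
    fun w a b ha hb => ((hC w).preconnected ⟨a, ha⟩ ⟨b, hb⟩).map
      (K.induceHomOfLE (hsub w w.2)).toHom
  have walk : ∀ (u v : S), (G.induce S).Walk u v → ∀ (a b : X) (ha : a ∈ C u) (hb : b ∈ C v),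
      (K.induce (⋃ w ∈ S, C w)).Reachable ⟨a, hsub u u.2 ha⟩ ⟨b, hsub v v.2 hb⟩ := by
    intro u v p
    induction p with
    | nil => exact same _
    | @cons u v w h p ih =>
      intro a b ha hb
      obtain ⟨x, hx, y, hy, hxy⟩ := hadj u v h
      have hstep : (K.induce (⋃ w ∈ S, C w)).Adj ⟨x, hsub u u.2 hx⟩ ⟨y, hsub v v.2 hy⟩ := hxy
      exact (same u a x ha hx).trans (hstep.reachable.trans (ih y b hy hb))
  obtain ⟨w⟩ := hS.nonempty
  obtain ⟨x⟩ := (hC w).nonempty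
  refine (connected_iff _).2 ⟨?_, ⟨⟨x, hsub w w.2 x.2⟩⟩⟩
  rintro ⟨a, ha⟩ ⟨b, hb⟩
  obtain ⟨u, hu, hau⟩ := Set.mem_iUnion₂.1 ha
  obtain ⟨v, hv, hbv⟩ := Set.mem_iUnion₂.1 hb
  obtain ⟨p⟩ := hS.preconnected ⟨u, hu⟩ ⟨v, hv⟩
  exact walk _ _ p a b hau hbv

lemma disjoint_biUnion_of_pairwise {C : W → Set X} (hC : ∀ u v, u ≠ v → Disjoint (C u) (C v))
    {S T : Set W} (h : Disjoint S T) : Disjoint (⋃ w ∈ S, C w) (⋃ w ∈ T, C w) := by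
  simp only [Set.disjoint_iUnion_left, Set.disjoint_iUnion_right]
  exact fun u hu v hv => hC _ _ (by rintro rfl; exact Set.disjoint_left.1 h ‹_› ‹_›)

lemma exists_adj_biUnion {G : SimpleGraph W} {K : SimpleGraph X} {C : W → Set X}
    (hadj : ∀ u v, G.Adj u v → ∃ x ∈ C u, ∃ y ∈ C v, K.Adj x y) {S T : Set W}
    (h : ∃ u ∈ S, ∃ v ∈ T, G.Adj u v) :
    ∃ x ∈ ⋃ w ∈ S, C w, ∃ y ∈ ⋃ w ∈ T, C w, K.Adj x y := by
  obtain ⟨u, hu, v, hv, huv⟩ := h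
  obtain ⟨x, hx, y, hy, hxy⟩ := hadj u v huv
  exact ⟨x, Set.mem_biUnion hu hx, y, Set.mem_biUnion hv hy, hxy⟩

end SimpleGraph

namespace IsMinor

open SimpleGraph

variable {V W X : Type*}

lemma trans {H : SimpleGraph V} {G : SimpleGraph W} {K : SimpleGraph X}
    (h : IsMinor H G) (h' : IsMinor G K) : IsMinor H K := by
  obtain ⟨B, hB, hBd, hBa⟩ := h
  obtain ⟨C, hC, hCd, hCa⟩ := h'
  exact ⟨fun v => ⋃ w ∈ B v, C w, fun v => connected_induce_biUnion hC hCa (hB v),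
    fun u v huv => disjoint_biUnion_of_pairwise hCd (hBd u v huv),
    fun u v huv => exists_adj_biUnion hCa (hBa u v huv)⟩

lemma of_embedding {H : SimpleGraph V} {G : SimpleGraph W} (e : H ↪g G) : IsMinor H G := by
  refine ⟨fun v => {e v}, fun v => ?_, fun u v huv => ?_, fun u v huv => ?_⟩
  · exact (connected_iff _).2 ⟨.of_subsingleton, inferInstance⟩
  · simpa using fun h => huv h
  · exact ⟨_, rfl, _, rfl, e.map_rel_iff.2 huv⟩

end IsMinor

namespace SimpleGraph

/-- The disjoint union of the graphs `G i`, together with an apex vertex `none` adjacent to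
every other vertex. -/
def sigmaApex {ι : Type*} {V : ι → Type*} (G : ∀ i, SimpleGraph (V i)) :
    SimpleGraph (Option (Σ i, V i)) where
  Adj
    | none, none => False
    | none, some _ => True
    | some _, none => True
    | some x, some y => ∃ h : x.1 = y.1, (G y.1).Adj (h ▸ x.2) y.2
  symm := ⟨by
    rintro (_ | ⟨i, x⟩) (_ | ⟨j, y⟩) h
    · exact h
    · trivial
    · trivial
    · obtain ⟨h, hxy⟩ := h
      dsimp only at h
      subst h
      exact ⟨rfl, hxy.symm⟩⟩
  loopless := ⟨by
    rintro (_ | ⟨i, x⟩) h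
    · exact h
    · exact (G i).loopless.irrefl x h.2⟩

variable {ι : Type*} {V : ι → Type*} (G : ∀ i, SimpleGraph (V i))

lemma sigmaApex_adj_same {i : ι} {x y : V i} :
    (sigmaApex G).Adj (some ⟨i, x⟩) (some ⟨i, y⟩) ↔ (G i).Adj x y :=
  ⟨fun h => h.2, fun h => ⟨rfl, h⟩⟩

/-- The inclusion of a summand. -/
def sigmaApexEmbedding (i : ι) : G i ↪g sigmaApex G where
  toFun x := some ⟨i, x⟩
  inj' x y h := by simpa using h
  map_rel_iff' := sigmaApex_adj_same G

variable {G}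

/-- If adding an apex to `G i` (and possibly more) does not leave the minors of `G i`, then
nesting copies of the apex branch set yields an infinite complete minor. -/
lemma isMinor_top_of_isMinor_sigmaApex {i : ι} (h : IsMinor (sigmaApex G) (G i)) :
    IsMinor (⊤ : SimpleGraph ℕ) (G i) := by
  obtain ⟨B, hB, hBd, hBa⟩ := h
  let C : V i → Set (V i) := fun x => B (some ⟨i, x⟩)
  have hC : ∀ x, ((G i).induce (C x)).Connected := fun x => hB _
  have hCd : ∀ x y, x ≠ y → Disjoint (C x) (C y) := fun x y hxy => hBd _ _ (by simpa using hxy)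
  have hCa : ∀ x y, (G i).Adj x y → ∃ a ∈ C x, ∃ b ∈ C y, (G i).Adj a b :=
    fun x y hxy => hBa _ _ ((sigmaApex_adj_same G).2 hxy)
  let A : ℕ → Set (V i) := fun n => Nat.rec (B none) (fun _ S => ⋃ x ∈ S, C x) n
  have hA : ∀ n, ((G i).induce (A n)).Connected := by
    intro n
    induction n with
    | zero => exact hB none
    | succ n ih => exact connected_induce_biUnion hC hCa ih
  have hlt : ∀ m n, m < n → Disjoint (A m) (A n) ∧ ∃ x ∈ A m, ∃ y ∈ A n, (G i).Adj x y := by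
    intro m
    induction m with
    | zero =>
      rintro (_ | n) hn
      · omega
      constructor
      · change Disjoint (B none) (⋃ x ∈ A n, C x)
        simp only [Set.disjoint_iUnion_right]
        exact fun x _ => hBd _ _ (by simp)
      · obtain ⟨x, hx⟩ := (hA n).nonempty
        obtain ⟨a, ha, b, hb, hab⟩ := hBa none (some ⟨i, x⟩) trivial
        exact ⟨a, ha, b, Set.mem_biUnion hx hb, hab⟩
    | succ m ih =>
      rintro (_ | n) hn
      · omega
      obtain ⟨hd, ha⟩ := ih n (by omega)
      exact ⟨disjoint_biUnion_of_pairwise hCd hd, exists_adj_biUnion hCa ha⟩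
  refine ⟨A, hA, fun m n hmn => ?_, fun m n hmn => ?_⟩
  · rcases hmn.lt_or_gt with h | h
    · exact (hlt m n h).1
    · exact (hlt n m h).1.symm
  · rcases (top_adj m n |>.1 hmn).lt_or_gt with h | h
    · exact (hlt m n h).2
    · obtain ⟨x, hx, y, hy, hxy⟩ := (hlt n m h).2
      exact ⟨y, hy, x, hx, hxy.symm⟩

/-- A connected set avoiding the apex lies in a single summand. -/
lemma exists_eq_image_of_connected_induce_sigmaApex {S : Set (Option (Σ i, V i))}
    (hS : ((sigmaApex G).induce S).Connected) (hnone : none ∉ S) :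
    ∃ i, S = sigmaApexEmbedding G i '' (sigmaApexEmbedding G i ⁻¹' S) := by
  obtain ⟨⟨_ | ⟨i, x⟩, ha⟩⟩ := hS.nonempty
  · exact absurd ha hnone
  have key : ∀ u v : S, ((sigmaApex G).induce S).Walk u v →
      u.1 ∈ Set.range (sigmaApexEmbedding G i) → v.1 ∈ Set.range (sigmaApexEmbedding G i) := by
    intro u v p
    induction p with
    | nil => exact id
    | @cons u v w h p ih =>
      rintro ⟨y, hy⟩
      refine ih ?_
      obtain ⟨_ | ⟨j, z⟩, hv⟩ := v
      · exact absurd hv hnone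
      · have h' : (sigmaApex G).Adj u.1 (some ⟨j, z⟩) := h
        rw [← hy] at h'
        obtain ⟨hij, -⟩ := h'
        dsimp only at hij
        subst hij
        exact ⟨z, rfl⟩
  refine ⟨i, (Set.image_preimage_eq_of_subset fun b hb => ?_).symm⟩
  obtain ⟨p⟩ := hS.preconnected ⟨_, ha⟩ ⟨b, hb⟩
  exact key _ _ p ⟨x, rfl⟩

lemma exists_isMinor_top_of_sigmaApex (h : IsMinor (⊤ : SimpleGraph ℕ) (sigmaApex G)) :
    ∃ i, IsMinor (⊤ : SimpleGraph ℕ) (G i) := by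
  obtain ⟨B, hB, hBd, hBa⟩ := h
  obtain ⟨k, hk⟩ : ∃ k, ∀ n, none ∉ B (n + k) := by
    by_cases hex : ∃ m, none ∈ B m
    · obtain ⟨m, hm⟩ := hex
      exact ⟨m + 1, fun n hn => Set.disjoint_left.1 (hBd m (n + (m + 1)) (by omega)) hm hn⟩
    · exact ⟨0, fun n hn => hex ⟨_, hn⟩⟩
  choose f hf using fun n => exists_eq_image_of_connected_induce_sigmaApex (hB (n + k)) (hk n)
  have hadj : ∀ m n, m ≠ n → ∃ x ∈ B (m + k), ∃ y ∈ B (n + k), (sigmaApex G).Adj x y :=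
    fun m n hmn => hBa _ _ (by simpa using hmn)
  have hconst : ∀ n, f n = f 0 := by
    intro n
    by_cases hn : n = 0
    · rw [hn]
    obtain ⟨x, hx, y, hy, hxy⟩ := hadj n 0 hn
    rw [hf] at hx hy
    obtain ⟨x, -, rfl⟩ := hx
    obtain ⟨y, -, rfl⟩ := hy
    exact hxy.1
  set e := sigmaApexEmbedding G (f 0)
  replace hf : ∀ n, B (n + k) = e '' (e ⁻¹' B (n + k)) := by
    intro n
    have h := hf n
    rwa [hconst n] at h
  refine ⟨f 0, fun n => e ⁻¹' B (n + k), fun n => ?_, fun m n hmn => ?_, fun m n hmn => ?_⟩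
  · let φ : e ⁻¹' B (n + k) → B (n + k) := fun x => ⟨e x, x.2⟩
    have hφ : Function.Bijective φ := by
      refine ⟨fun x y h => Subtype.ext (e.injective (Subtype.ext_iff.1 h)), ?_⟩
      rintro ⟨y, hy⟩
      obtain ⟨x, hx, rfl⟩ := (hf n).subset hy
      exact ⟨⟨x, hx⟩, rfl⟩
    let ψ : (G (f 0)).induce (e ⁻¹' B (n + k)) ≃g (sigmaApex G).induce (B (n + k)) :=
      ⟨Equiv.ofBijective φ hφ, e.map_rel_iff⟩
    exact ψ.connected_iff.2 (hB _)
  · exact (hBd _ _ (by simpa using hmn)).preimage _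
  · obtain ⟨x, hx, y, hy, hxy⟩ := hadj m n hmn
    rw [hf] at hx hy
    obtain ⟨x, hx, rfl⟩ := hx
    obtain ⟨y, hy, rfl⟩ := hy
    exact ⟨x, hx, y, hy, e.map_rel_iff.1 hxy⟩

end SimpleGraph

/-- There are uncountably many (pairwise distinct) minor-closed classes of countable
graphs each having a minor-universal element. -/
theorem uncountably_many_classes_with_universal :
    ∃ F : Set (Set CGraph), ¬ F.Countable ∧
      ∀ C ∈ F, MinorClosed C ∧ HasUniversal C := by
  let D : CGraph → Set CGraph := fun U => {H | IsMinor H.graph U.graph}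
  have hrefl : ∀ U : CGraph, U ∈ D U := fun U => .of_embedding .refl
  let N : Set CGraph := {U | ¬ IsMinor (⊤ : SimpleGraph ℕ) U.graph}
  refine ⟨D '' N, fun hcount => ?_, ?_⟩
  · have hne : N.Nonempty := by
      refine ⟨⟨Empty, inferInstance, ⊥⟩, fun ⟨B, hB, _⟩ => ?_⟩
      obtain ⟨x⟩ := (hB 0).nonempty
      exact x.1.elim
    obtain ⟨f, hf⟩ := hcount.exists_eq_range (hne.image D)
    choose U hUN hUf using fun n => (hf ▸ Set.mem_range_self n : f n ∈ D '' N)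
    have := fun n => (U n).countable
    let W : CGraph := ⟨_, inferInstance, SimpleGraph.sigmaApex fun n => (U n).graph⟩
    have hW : W ∈ N := fun h =>
      let ⟨n, hn⟩ := SimpleGraph.exists_isMinor_top_of_sigmaApex h
      hUN n hn
    obtain ⟨n, hn⟩ : D W ∈ Set.range f := hf ▸ Set.mem_image_of_mem D hW
    have hWU : W ∈ D (U n) := by
      rw [hUf, hn]
      exact hrefl W
    exact hUN n (SimpleGraph.isMinor_top_of_isMinor_sigmaApex (G := fun n => (U n).graph) hWU)
  · rintro _ ⟨U, -, rfl⟩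
    exact ⟨fun G hG H hH => hH.trans hG, U, hrefl U, fun G hG => hG⟩
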